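/- arXiv:1612.01710 — 2 statements merged into one kernel-verified Lean document; each statement's English description precedes it below -/
import Mathlib

section
/- Let 𝓗 be a complex Hilbert space and D ⊆ 𝓗 a dense subspace. Let H : D → 𝓗 and, for each t ∈ ℝ, H(t) : D → 𝓗 be linear maps. Let U₀ : ℝ → B(𝓗) satisfy: each U₀(σ) is unitary, U₀(0) = 1, U₀(σ+σ') = U₀(σ)U₀(σ'), U₀(σ)[D] ⊆ D, the map σ ↦ U₀(σ)x is continuous for every x ∈ 𝓗, and for every ψ ∈ D the map σ ↦ U₀(σ)ψ is differentiable at every σ with derivative −i·H(U₀(σ)ψ). Let U : ℝ×ℝ → B(𝓗) satisfy: each U(t,s) is unitary, U(t,t) = 1, U(t,s)[D] ⊆ D, (t,s) ↦ U(t,s)x is jointly continuous for every x ∈ 𝓗, and for every ψ ∈ D and s,t ∈ ℝ the map t' ↦ U(t',s)ψ is differentiable at every t' with derivative −i·H(t')(U(t',s)ψ), while the map s' ↦ U(t,s')ψ is differentiable at every s' with derivative +i·U(t,s')(H(s')ψ). Assume in addition that for every ψ ∈ D and s,t ∈ ℝ the maps τ ↦ H(U(τ,s)ψ), τ ↦ H(τ)(U(τ,s)ψ),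 τ ↦ H(U₀(τ−s)ψ) and τ ↦ H(τ)(U₀(τ−s)ψ) are continuous on the closed interval with endpoints s and t. Then for all ψ ∈ D and all s,t ∈ ℝ the Duhamel formulas hold: (U(t,s) − U₀(t−s))ψ = i ∫_s^t U₀(t−τ)((H − H(τ))(U(τ,s)ψ)) dτ and (U(t,s) − U₀(t−s))ψ = i ∫_s^t U(t,τ)((H − H(τ))(U₀(τ−s)ψ)) dτ, where the integrals are Bochner integrals in 𝓗. -/
section StronglyContinuousFamily

open Topology Asymptotics Filter

variable {E F : Type*} [NormedAddCommGroup E] [NormedSpace ℂ E]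
  [NormedAddCommGroup F] [NormedSpace ℂ F]

/-- Product rule for a uniformly bounded, strongly continuous family of operators applied to a
differentiable curve. -/
theorem HasDerivAt.clm_apply_of_strongly_continuous {A : ℝ → E →L[ℂ] F} {C : ℝ}
    (hA : ∀ σ, ‖A σ‖ ≤ C) {v : ℝ → E} {v' : E} {w : F} {τ : ℝ}
    (hcont : ContinuousAt (fun σ => A σ v') τ)
    (hw : HasDerivAt (fun σ => A σ (v τ)) w τ) (hv : HasDerivAt v v' τ) :
    HasDerivAt (fun σ => A σ (v σ)) (w + A τ v') τ := by
  rw [hasDerivAt_iff_isLittleO] at hw hv ⊢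
  have h₁ : (fun σ => A σ (v σ - v τ - (σ - τ) • v')) =o[𝓝 τ] fun σ => σ - τ := by
    refine IsBigO.trans_isLittleO (IsBigO.of_bound C (Eventually.of_forall fun σ => ?_)) hv
    exact (A σ).le_of_opNorm_le (hA σ) _
  have h₂ : (fun σ => (σ - τ) • (A σ v' - A τ v')) =o[𝓝 τ] fun σ => σ - τ := by
    have h : (fun σ => A σ v' - A τ v') =o[𝓝 τ] fun _ => (1 : ℝ) := by
      rw [isLittleO_one_iff]
      simpa using hcont.tendsto.sub_const (A τ v')
    simpa using (isBigO_refl (fun σ : ℝ => σ - τ) (𝓝 τ)).smul_isLittleO h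
  refine ((h₁.add h₂).add hw).congr_left fun σ => ?_
  have hsmul : A σ ((σ - τ) • v') = (σ - τ) • A σ v' := (A σ).map_smul_of_tower _ _
  simp only [map_sub, hsmul, smul_sub, smul_add]
  abel

/-- A uniformly bounded, strongly continuous family of operators maps continuous curves to
continuous curves. -/
theorem ContinuousOn.clm_apply_of_strongly_continuous {A : ℝ → E →L[ℂ] F} {C : ℝ}
    (hA : ∀ σ, ‖A σ‖ ≤ C) (hcont : ∀ x, Continuous fun σ => A σ x) {g : ℝ → E} {S : Set ℝ}
    (hg : ContinuousOn g S) : ContinuousOn (fun σ => A σ (g σ)) S := by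
  intro τ hτ
  have h₁ : Tendsto (fun σ => A σ (g σ - g τ)) (𝓝[S] τ) (𝓝 0) := by
    refine squeeze_zero_norm (fun σ => (A σ).le_of_opNorm_le (hA σ) _) ?_
    simpa using ((hg τ hτ).tendsto.sub_const (g τ)).norm.const_mul C
  have h₂ := h₁.add ((hcont (g τ)).continuousWithinAt (s := S) (x := τ)).tendsto
  simpa [ContinuousWithinAt] using h₂

/-- Differentiability at `0` of an orbit of a one-parameter group propagates to all times, with
the group applied to the derivative at `0`. -/
theorem hasDerivAt_group_const_sub {U₀ : ℝ → E →L[ℂ] E}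
    (hadd : ∀ σ σ' : ℝ, U₀ (σ + σ') = U₀ σ * U₀ σ') {x y : E}
    (h : HasDerivAt (fun σ => U₀ σ x) y 0) (t τ : ℝ) :
    HasDerivAt (fun σ => U₀ (t - σ) x) (-U₀ (t - τ) y) τ := by
  have h' : HasDerivAt (fun σ => U₀ σ x) y (τ - τ) := by rwa [sub_self]
  have h₁ := ((U₀ (t - τ)).restrictScalars ℝ).hasFDerivAt.comp_hasDerivAt τ (h'.comp_const_sub τ τ)
  refine (h₁.congr_deriv (by simp)).congr_of_eventuallyEq (Eventually.of_forall fun σ => ?_)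
  have hσ : t - σ = (t - τ) + (τ - σ) := by ring
  change U₀ (t - σ) x = U₀ (t - τ) (U₀ (τ - σ) x)
  rw [hσ, hadd, mul_apply_eq_comp]

end StronglyContinuousFamily

theorem ContinuousLinearMap.norm_le_one_of_mem_unitary {𝓗 : Type*} [NormedAddCommGroup 𝓗]
    [InnerProductSpace ℂ 𝓗] [CompleteSpace 𝓗] {V : 𝓗 →L[ℂ] 𝓗}
    (hV : V ∈ unitary (𝓗 →L[ℂ] 𝓗)) : ‖V‖ ≤ 1 :=
  V.opNorm_le_bound zero_le_one fun x => by
    rw [one_mul, ContinuousLinearMap.norm_map_of_mem_unitary hV]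

/-- Duhamel formulas comparing the unitary propagator `U(t,s)` generated by a time-dependent
Hamiltonian `H(t)` with common dense domain `D` with the unitary group `U₀` generated by `H`:
`(U(t,s) − U₀(t−s))ψ = i ∫_s^t U₀(t−τ)((H − H(τ))U(τ,s)ψ) dτ
                     = i ∫_s^t U(t,τ)((H − H(τ))U₀(τ−s)ψ) dτ` for all `ψ ∈ D`. -/
theorem stmt_0 {𝓗 : Type*} [NormedAddCommGroup 𝓗] [InnerProductSpace ℂ 𝓗] [CompleteSpace 𝓗]
    (D : Submodule ℂ 𝓗) (hD : Dense (D : Set 𝓗))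
    (H : D →ₗ[ℂ] 𝓗) (Ht : ℝ → (D →ₗ[ℂ] 𝓗))
    (U₀ : ℝ → 𝓗 →L[ℂ] 𝓗)
    (hU₀unit : ∀ σ : ℝ, U₀ σ ∈ unitary (𝓗 →L[ℂ] 𝓗))
    (hU₀zero : U₀ 0 = 1)
    (hU₀add : ∀ σ σ' : ℝ, U₀ (σ + σ') = U₀ σ * U₀ σ')
    (hU₀D : ∀ (σ : ℝ) (ψ : D), U₀ σ (ψ : 𝓗) ∈ D)
    (hU₀cont : ∀ x : 𝓗, Continuous fun σ : ℝ => U₀ σ x)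
    (hU₀deriv : ∀ (ψ : D) (σ : ℝ),
      HasDerivAt (fun τ : ℝ => U₀ τ (ψ : 𝓗))
        ((-Complex.I) • H (⟨U₀ σ (ψ : 𝓗), hU₀D σ ψ⟩ : D)) σ)
    (U : ℝ → ℝ → 𝓗 →L[ℂ] 𝓗)
    (hUunit : ∀ t s : ℝ, U t s ∈ unitary (𝓗 →L[ℂ] 𝓗))
    (hUid : ∀ t : ℝ, U t t = 1)
    (hUD : ∀ (t s : ℝ) (ψ : D), U t s (ψ : 𝓗) ∈ D)
    (hUcont : ∀ x : 𝓗, Continuous fun p : ℝ × ℝ => U p.1 p.2 x)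
    (hUderiv_t : ∀ (ψ : D) (s t' : ℝ),
      HasDerivAt (fun t'' : ℝ => U t'' s (ψ : 𝓗))
        ((-Complex.I) • Ht t' (⟨U t' s (ψ : 𝓗), hUD t' s ψ⟩ : D)) t')
    (hUderiv_s : ∀ (ψ : D) (t s' : ℝ),
      HasDerivAt (fun s'' : ℝ => U t s'' (ψ : 𝓗))
        (Complex.I • U t s' (Ht s' ψ)) s')
    (hcont₁ : ∀ (ψ : D) (s t : ℝ),
      ContinuousOn (fun τ : ℝ => H (⟨U τ s (ψ : 𝓗), hUD τ s ψ⟩ : D)) (Set.uIcc s t))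
    (hcont₂ : ∀ (ψ : D) (s t : ℝ),
      ContinuousOn (fun τ : ℝ => Ht τ (⟨U τ s (ψ : 𝓗), hUD τ s ψ⟩ : D)) (Set.uIcc s t))
    (hcont₃ : ∀ (ψ : D) (s t : ℝ),
      ContinuousOn (fun τ : ℝ => H (⟨U₀ (τ - s) (ψ : 𝓗), hU₀D (τ - s) ψ⟩ : D)) (Set.uIcc s t))
    (hcont₄ : ∀ (ψ : D) (s t : ℝ),
      ContinuousOn (fun τ : ℝ => Ht τ (⟨U₀ (τ - s) (ψ : 𝓗), hU₀D (τ - s) ψ⟩ : D))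
        (Set.uIcc s t)) :
    ∀ (ψ : D) (s t : ℝ),
      U t s (ψ : 𝓗) - U₀ (t - s) (ψ : 𝓗) =
        Complex.I • ∫ τ in s..t,
          U₀ (t - τ) (H (⟨U τ s (ψ : 𝓗), hUD τ s ψ⟩ : D) -
            Ht τ (⟨U τ s (ψ : 𝓗), hUD τ s ψ⟩ : D)) ∧
      U t s (ψ : 𝓗) - U₀ (t - s) (ψ : 𝓗) =
        Complex.I • ∫ τ in s..t,
          U t τ (H (⟨U₀ (τ - s) (ψ : 𝓗), hU₀D (τ - s) ψ⟩ : D) -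
            Ht τ (⟨U₀ (τ - s) (ψ : 𝓗), hU₀D (τ - s) ψ⟩ : D)) := by
  intro ψ s t
  have hU₀bd : ∀ σ, ‖U₀ σ‖ ≤ 1 := fun σ =>
    ContinuousLinearMap.norm_le_one_of_mem_unitary (hU₀unit σ)
  have hUbd : ∀ t s, ‖U t s‖ ≤ 1 := fun t s =>
    ContinuousLinearMap.norm_le_one_of_mem_unitary (hUunit t s)
  have hU₀strong : ∀ x, Continuous fun τ => U₀ (t - τ) x :=
    fun x => (hU₀cont x).comp (continuous_const.sub continuous_id)
  have hUstrong : ∀ x, Continuous fun τ => U t τ x :=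
    fun x => (hUcont x).comp (continuous_const.prodMk continuous_id)
  have hgen : ∀ φ : D, HasDerivAt (fun σ => U₀ σ (φ : 𝓗)) ((-Complex.I) • H φ) 0 := by
    intro φ
    have hφ : (⟨U₀ 0 (φ : 𝓗), hU₀D 0 φ⟩ : D) = φ := Subtype.ext (by simp [hU₀zero])
    simpa only [hφ] using hU₀deriv φ 0
  constructor
  · have hderiv : ∀ τ ∈ Set.uIcc s t, HasDerivAt (fun τ => U₀ (t - τ) (U τ s (ψ : 𝓗)))
        (Complex.I • U₀ (t - τ) (H (⟨U τ s (ψ : 𝓗), hUD τ s ψ⟩ : D) -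
            Ht τ (⟨U τ s (ψ : 𝓗), hUD τ s ψ⟩ : D))) τ := by
      intro τ _
      refine (HasDerivAt.clm_apply_of_strongly_continuous (fun σ => hU₀bd (t - σ))
        (hU₀strong _).continuousAt
        (hasDerivAt_group_const_sub hU₀add (hgen ⟨U τ s (ψ : 𝓗), hUD τ s ψ⟩) t τ)
        (hUderiv_t ψ s τ)).congr_deriv ?_
      simp only [map_smul, map_sub, map_neg, smul_sub, neg_smul, neg_neg]
      abel
    have hint := (((hcont₁ ψ s t).sub (hcont₂ ψ s t)).clm_apply_of_strongly_continuous
      (fun σ => hU₀bd (t - σ)) hU₀strong).const_smul Complex.I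
    rw [← intervalIntegral.integral_smul,
      intervalIntegral.integral_eq_sub_of_hasDerivAt hderiv hint.intervalIntegrable]
    simp [hU₀zero, hUid]
  · have hderiv : ∀ τ ∈ Set.uIcc s t, HasDerivAt (fun τ => -U t τ (U₀ (τ - s) (ψ : 𝓗)))
        (Complex.I • U t τ (H (⟨U₀ (τ - s) (ψ : 𝓗), hU₀D (τ - s) ψ⟩ : D) -
            Ht τ (⟨U₀ (τ - s) (ψ : 𝓗), hU₀D (τ - s) ψ⟩ : D))) τ := by
      intro τ _
      refine (HasDerivAt.clm_apply_of_strongly_continuous (hUbd t)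
        (hUstrong _).continuousAt
        (hUderiv_s ⟨U₀ (τ - s) (ψ : 𝓗), hU₀D (τ - s) ψ⟩ t τ)
        ((hU₀deriv ψ (τ - s)).comp_sub_const τ s)).neg.congr_deriv ?_
      simp only [map_smul, map_sub, map_neg, smul_sub, neg_smul]
      abel
    have hint := (((hcont₃ ψ s t).sub (hcont₄ ψ s t)).clm_apply_of_strongly_continuous
      (hUbd t) hUstrong).const_smul Complex.I
    rw [← intervalIntegral.integral_smul,
      intervalIntegral.integral_eq_sub_of_hasDerivAt hderiv hint.intervalIntegrable]
    simp [hU₀zero, hUid]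
    abel
end

section
/- Let U : ℝ → B(𝓗) be a strongly continuous one-parameter unitary group on a complex Hilbert space 𝓗. Let K := {x ∈ 𝓗 : U(t)x = x for all t ∈ ℝ}; K is a closed subspace of 𝓗, and let P_K denote the orthogonal projection onto K. Then for every x ∈ 𝓗 the Bochner integral ∫_0^∞ e^{−ετ} U(τ)x dτ exists for each ε > 0, and ε ∫_0^∞ e^{−ετ} U(τ)x dτ → P_K x in the norm of 𝓗 as ε → 0⁺. Equivalently, the bounded operators x ↦ x − ε ∫_0^∞ e^{−ετ} U(τ)x dτ converge, in the strong operator topology as ε → 0⁺, to the orthogonal projection onto the orthogonal complement K^⊥. -/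
open MeasureTheory Filter

section AbelMean

open Set Topology

variable {𝓗 : Type*} [NormedAddCommGroup 𝓗] [InnerProductSpace ℂ 𝓗]

/-- The Abel mean `ε ∫_0^∞ e^{−ετ} U(τ)x dτ` of the orbit of `x`. -/
noncomputable def abelMean (U : ℝ → 𝓗 →L[ℂ] 𝓗) (ε : ℝ) (x : 𝓗) : 𝓗 :=
  ε • ∫ τ in Ioi (0 : ℝ), Real.exp (-ε * τ) • U τ x

variable {U : ℝ → 𝓗 →L[ℂ] 𝓗} {ε : ℝ}

theorem integrableOn_exp_smul_orbit (hnorm : ∀ t x, ‖U t x‖ = ‖x‖)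
    (hcont : ∀ x, Continuous fun t => U t x) (hε : 0 < ε) (x : 𝓗) (a : ℝ) :
    IntegrableOn (fun τ : ℝ => Real.exp (-ε * τ) • U τ x) (Ioi a) := by
  have hexp := integrableOn_exp_mul_Ioi (neg_lt_zero.mpr hε) a
  refine (hexp.mul_const ‖x‖).mono' ?_ (ae_of_all _ fun τ => ?_)
  · have := hcont x
    exact Continuous.aestronglyMeasurable (by fun_prop)
  · rw [norm_smul, hnorm, Real.norm_of_nonneg (Real.exp_nonneg _)]

theorem integral_exp_neg_mul_Ioi_zero (hε : 0 < ε) :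
    ∫ τ in Ioi (0 : ℝ), Real.exp (-ε * τ) = ε⁻¹ := by
  rw [integral_exp_mul_Ioi (neg_lt_zero.mpr hε)]
  simp

theorem norm_abelMean_le (hnorm : ∀ t x, ‖U t x‖ = ‖x‖) (hε : 0 < ε) (x : 𝓗) :
    ‖abelMean U ε x‖ ≤ ‖x‖ := by
  have hexp := integrableOn_exp_mul_Ioi (neg_lt_zero.mpr hε) 0
  have hle : ‖∫ τ in Ioi (0 : ℝ), Real.exp (-ε * τ) • U τ x‖ ≤ ε⁻¹ * ‖x‖ := by
    rw [← integral_exp_neg_mul_Ioi_zero hε, ← integral_mul_const]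
    refine norm_integral_le_of_norm_le (hexp.mul_const ‖x‖) (ae_of_all _ fun τ => ?_)
    rw [norm_smul, hnorm, Real.norm_of_nonneg (Real.exp_nonneg _)]
  rw [abelMean, norm_smul, Real.norm_of_nonneg hε.le]
  calc ε * _ ≤ ε * (ε⁻¹ * ‖x‖) := by gcongr
    _ = ‖x‖ := by field_simp

theorem abelMean_add (hnorm : ∀ t x, ‖U t x‖ = ‖x‖)
    (hcont : ∀ x, Continuous fun t => U t x) (hε : 0 < ε) (x y : 𝓗) :
    abelMean U ε (x + y) = abelMean U ε x + abelMean U ε y := by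
  simp only [abelMean, map_add, smul_add]
  rw [integral_add (integrableOn_exp_smul_orbit hnorm hcont hε x 0)
    (integrableOn_exp_smul_orbit hnorm hcont hε y 0), smul_add]

theorem abelMean_smul (c : ℂ) (x : 𝓗) : abelMean U ε (c • x) = c • abelMean U ε x := by
  simp only [abelMean, map_smul, smul_comm _ c, integral_smul]

theorem abelMean_sub (hnorm : ∀ t x, ‖U t x‖ = ‖x‖)
    (hcont : ∀ x, Continuous fun t => U t x) (hε : 0 < ε) (x y : 𝓗) :
    abelMean U ε (x - y) = abelMean U ε x - abelMean U ε y := by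
  rw [eq_sub_iff_add_eq, ← abelMean_add hnorm hcont hε, sub_add_cancel]

theorem abelMean_eq_self [CompleteSpace 𝓗] (hε : 0 < ε) {x : 𝓗} (hx : ∀ t, U t x = x) :
    abelMean U ε x = x := by
  simp only [abelMean, hx]
  rw [integral_smul_const, integral_exp_neg_mul_Ioi_zero hε, smul_inv_smul₀ hε.ne']

theorem abelMean_map (hnorm : ∀ t x, ‖U t x‖ = ‖x‖) (hadd : ∀ t s, U (t + s) = U t * U s)
    (hcont : ∀ x, Continuous fun t => U t x) (hε : 0 < ε) (t : ℝ) (x : 𝓗) :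
    abelMean U ε (U t x) = Real.exp (ε * t) • (abelMean U ε x -
      ε • ∫ τ in (0 : ℝ)..t, Real.exp (-ε * τ) • U τ x) := by
  have hshift : ∫ τ in Ioi (0 : ℝ), Real.exp (-ε * τ) • U τ (U t x) =
      Real.exp (ε * t) • ∫ τ in Ioi t, Real.exp (-ε * τ) • U τ x := by
    have hpre := (measurePreserving_add_right volume t).setIntegral_preimage_emb
      (measurableEmbedding_addRight t) (fun τ : ℝ => Real.exp (-ε * τ) • U τ x) (Ioi t)
    rw [preimage_add_const_Ioi, sub_self] at hpre
    rw [← hpre, ← integral_smul]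
    refine integral_congr_ae (ae_of_all _ fun τ => ?_)
    simp only [hadd, smul_smul, ← Real.exp_add, mul_apply_eq_comp]
    ring_nf
  have hsplit := intervalIntegral.integral_interval_add_Ioi
    (integrableOn_exp_smul_orbit hnorm hcont hε x 0)
    (integrableOn_exp_smul_orbit hnorm hcont hε x t)
  rw [abelMean, hshift, abelMean, ← hsplit, smul_add, add_sub_cancel_left, smul_comm]

theorem tendsto_abelMean_map_sub_self (hnorm : ∀ t x, ‖U t x‖ = ‖x‖)
    (hadd : ∀ t s, U (t + s) = U t * U s) (hcont : ∀ x, Continuous fun t => U t x)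
    (t : ℝ) (x : 𝓗) :
    Tendsto (fun ε => abelMean U ε (U t x - x)) (𝓝[>] 0) (𝓝 0) := by
  set C := Real.exp |t| * ‖x‖ * |t - 0|
  have hbound : Tendsto (fun ε : ℝ => |Real.exp (ε * t) - 1| * ‖x‖ +
      |Real.exp (ε * t) * ε| * C) (𝓝[>] 0) (𝓝 0) := by
    refine tendsto_nhdsWithin_of_tendsto_nhds ?_
    refine Continuous.tendsto' (by fun_prop) _ _ (by simp)
  refine squeeze_zero_norm' ?_ hbound
  filter_upwards [Ioo_mem_nhdsGT (zero_lt_one (α := ℝ))] with ε ⟨hε, hε1⟩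
  have hJ : ‖∫ τ in (0 : ℝ)..t, Real.exp (-ε * τ) • U τ x‖ ≤ C := by
    refine intervalIntegral.norm_integral_le_of_norm_le_const fun τ hτ => ?_
    rw [norm_smul, hnorm, Real.norm_of_nonneg (Real.exp_nonneg _)]
    have hτt : |τ| ≤ |t| := by
      simpa using abs_sub_left_of_mem_uIcc (uIoc_subset_uIcc hτ)
    have : -ε * τ ≤ |t| := by
      calc -ε * τ ≤ |-ε * τ| := le_abs_self _
        _ = ε * |τ| := by rw [abs_mul, abs_neg, abs_of_pos hε]
        _ ≤ 1 * |t| := by gcongr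
        _ = |t| := one_mul _
    gcongr
  have heq : abelMean U ε (U t x - x) = (Real.exp (ε * t) - 1) • abelMean U ε x -
      (Real.exp (ε * t) * ε) • ∫ τ in (0 : ℝ)..t, Real.exp (-ε * τ) • U τ x := by
    rw [abelMean_sub hnorm hcont hε, abelMean_map hnorm hadd hcont hε]
    module
  rw [heq]
  refine (norm_sub_le _ _).trans ?_
  rw [norm_smul, norm_smul, Real.norm_eq_abs, Real.norm_eq_abs]
  gcongr
  exact norm_abelMean_le hnorm hε x

theorem tendsto_abelMean_of_mem_span (hnorm : ∀ t x, ‖U t x‖ = ‖x‖)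
    (hadd : ∀ t s, U (t + s) = U t * U s) (hcont : ∀ x, Continuous fun t => U t x) {x : 𝓗}
    (hx : x ∈ Submodule.span ℂ (range fun p : ℝ × 𝓗 => U p.1 p.2 - p.2)) :
    Tendsto (fun ε => abelMean U ε x) (𝓝[>] 0) (𝓝 0) := by
  induction hx using Submodule.span_induction with
  | mem _ h =>
    obtain ⟨⟨t, z⟩, rfl⟩ := h
    exact tendsto_abelMean_map_sub_self hnorm hadd hcont t z
  | zero => simp [abelMean]
  | add y z _ _ hy hz =>
    rw [← add_zero (0 : 𝓗)]
    refine (hy.add hz).congr' ?_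
    filter_upwards [self_mem_nhdsWithin] with ε hε
    exact (abelMean_add hnorm hcont hε y z).symm
  | smul c y _ hy => simpa only [abelMean_smul, smul_zero] using hy.const_smul c

theorem isClosed_setOf_tendsto_abelMean_zero (hnorm : ∀ t x, ‖U t x‖ = ‖x‖)
    (hcont : ∀ x, Continuous fun t => U t x) :
    IsClosed {x : 𝓗 | Tendsto (fun ε => abelMean U ε x) (𝓝[>] 0) (𝓝 0)} := by
  refine isClosed_of_closure_subset fun x hx => ?_
  rw [mem_ofPred_eq, NormedAddGroup.tendsto_nhds_zero]
  intro δ hδ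
  obtain ⟨y, hy, hxy⟩ := Metric.mem_closure_iff.mp hx (δ / 2) (half_pos hδ)
  filter_upwards [NormedAddGroup.tendsto_nhds_zero.mp hy (δ / 2) (half_pos hδ),
    self_mem_nhdsWithin] with ε hyε hε
  calc ‖abelMean U ε x‖ = ‖abelMean U ε (x - y) + abelMean U ε y‖ := by
        rw [← abelMean_add hnorm hcont hε, sub_add_cancel]
    _ ≤ ‖abelMean U ε (x - y)‖ + ‖abelMean U ε y‖ := norm_add_le _ _
    _ ≤ ‖x - y‖ + ‖abelMean U ε y‖ := by gcongr; exact norm_abelMean_le hnorm hε _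
    _ < δ / 2 + δ / 2 := by gcongr; rwa [← dist_eq_norm]
    _ = δ := add_halves δ

theorem map_eq_self_of_mem_orthogonal_span (hnorm : ∀ t x, ‖U t x‖ = ‖x‖) {x : 𝓗}
    (hx : x ∈ (Submodule.span ℂ (range fun p : ℝ × 𝓗 => U p.1 p.2 - p.2))ᗮ) (t : ℝ) :
    U t x = x := by
  have h := (Submodule.mem_orthogonal _ _).mp hx _ (Submodule.subset_span ⟨(t, x), rfl⟩)
  rw [inner_sub_left, sub_eq_zero] at h
  refine eq_of_norm_le_re_inner_eq_norm_sq (𝕜 := ℂ) (hnorm t x).le ?_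
  rw [h, inner_self_eq_norm_sq]

end AbelMean

/-- Abel-mean ergodic theorem for a strongly continuous one-parameter unitary group: with `K`
the closed subspace of fixed vectors, the Abel means `ε ∫_0^∞ e^{−ετ} U(τ)x dτ` exist and
converge, as `ε → 0⁺`, to the orthogonal projection of `x` onto `K` (characterized as the
unique `y ∈ K` with `x − y ⊥ K`). -/
theorem stmt_2 {𝓗 : Type*} [NormedAddCommGroup 𝓗] [InnerProductSpace ℂ 𝓗] [CompleteSpace 𝓗]
    (U : ℝ → 𝓗 →L[ℂ] 𝓗)
    (hunit : ∀ t : ℝ, U t ∈ unitary (𝓗 →L[ℂ] 𝓗))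
    (h0 : U 0 = 1)
    (hadd : ∀ t s : ℝ, U (t + s) = U t * U s)
    (hcont : ∀ x : 𝓗, Continuous fun t : ℝ => U t x)
    (K : Submodule ℂ 𝓗) (hK : ∀ x : 𝓗, x ∈ K ↔ ∀ t : ℝ, U t x = x) :
    IsClosed (K : Set 𝓗) ∧
    (∀ ε : ℝ, 0 < ε → ∀ x : 𝓗,
      IntegrableOn (fun τ : ℝ => Real.exp (-ε * τ) • U τ x) (Set.Ioi 0)) ∧
    ∀ x : 𝓗, ∃ y : 𝓗, y ∈ K ∧ (x - y) ∈ Kᗮ ∧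
      Tendsto (fun ε : ℝ => ε • ∫ τ in Set.Ioi (0 : ℝ), Real.exp (-ε * τ) • U τ x)
        (nhdsWithin 0 (Set.Ioi 0)) (nhds y) := by
  have hnorm : ∀ t x, ‖U t x‖ = ‖x‖ := fun t => (U t).norm_map_of_mem_unitary (hunit t)
  have hclosed : IsClosed (K : Set 𝓗) := by
    have hinter : (K : Set 𝓗) = ⋂ t, {x | U t x = x} := by
      ext x
      simp [hK]
    rw [hinter]
    exact isClosed_iInter fun t => isClosed_eq (U t).continuous continuous_id
  refine ⟨hclosed, fun ε hε x => integrableOn_exp_smul_orbit hnorm hcont hε x 0, fun x => ?_⟩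
  have : CompleteSpace K := hclosed.completeSpace_coe
  have hxy := K.sub_starProjection_mem_orthogonal x
  have hyK := K.starProjection_apply_mem x
  set y := K.starProjection x
  refine ⟨y, hyK, hxy, ?_⟩
  have hlim : Tendsto (fun ε => abelMean U ε (x - y)) (nhdsWithin 0 (Set.Ioi 0)) (nhds 0) := by
    have hle := Submodule.orthogonal_le fun z hz =>
      (hK z).mpr (map_eq_self_of_mem_orthogonal_span hnorm hz)
    have hmem := hle hxy
    rw [Submodule.orthogonal_orthogonal_eq_closure] at hmem
    exact closure_minimal (fun _ => tendsto_abelMean_of_mem_span hnorm hadd hcont)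
      (isClosed_setOf_tendsto_abelMean_zero hnorm hcont) hmem
  rw [← zero_add y]
  refine (hlim.add_const y).congr' ?_
  filter_upwards [self_mem_nhdsWithin] with ε hε
  rw [abelMean_sub hnorm hcont hε, abelMean_eq_self hε ((hK y).mp hyK), sub_add_cancel, abelMean]
end
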